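/- arXiv:2111.07160 — 2 statements merged into one kernel-verified Lean document; each statement's English description precedes it below -/
import Mathlib

section
/- Let Δt ≥ 0, Σ_t ≥ 0 and let Σ = diag(σ₁,…,σ_m) ∈ ℝ^{m×m} be diagonal with 0 ≤ σ_k for all k. Let X_ℓ¹, X_{ℓ−1}¹ ∈ ℝ^{n×r} and W_ℓ¹, W_{ℓ−1}¹ ∈ ℝ^{m×r} have orthonormal columns, let S̃_ℓ^‡, S_{ℓ−1}¹ ∈ ℝ^{r×r}, and define S_ℓ¹ = (1 + ΔtΣ_t)^{-1}·( S̃_ℓ^‡ + Δt·X_ℓ^{1,T}X_{ℓ−1}¹S_{ℓ−1}¹W_{ℓ−1}^{1,T}·Σ·W_ℓ¹ ). Then ‖S_ℓ¹‖_F ≤ (1 + ΔtΣ_t)^{-1}·( ‖S̃_ℓ^‡‖_F + Δt·(max_k σ_k)·‖S_{ℓ−1}¹‖_F ). -/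
open Matrix

/-- The Frobenius norm of a real matrix. -/
noncomputable def frobNorm {α β : Type*} [Fintype α] [Fintype β] (A : Matrix α β ℝ) : ℝ :=
  Real.sqrt (∑ i, ∑ j, (A i j) ^ 2)

section helpers

lemma frobSq_eq {a b : ℕ} (A : Matrix (Fin a) (Fin b) ℝ) :
    ∑ i, ∑ j, (A i j) ^ 2 = (Aᵀ * A).trace := by
  simp only [Matrix.trace, Matrix.diag, Matrix.mul_apply, Matrix.transpose_apply]
  rw [Finset.sum_comm]
  simp only [pow_two]

lemma frobNorm_tr {a b : ℕ} (A : Matrix (Fin a) (Fin b) ℝ) : frobNorm Aᵀ = frobNorm A := by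
  unfold frobNorm
  rw [Finset.sum_comm]
  rfl

lemma frobNorm_iso {a b c : ℕ} (X : Matrix (Fin a) (Fin b) ℝ) (hX : Xᵀ * X = 1)
    (A : Matrix (Fin b) (Fin c) ℝ) : frobNorm (X * A) = frobNorm A := by
  unfold frobNorm
  rw [frobSq_eq, frobSq_eq, Matrix.transpose_mul, Matrix.mul_assoc, ← Matrix.mul_assoc Xᵀ, hX,
    Matrix.one_mul]

lemma frobNorm_contr {a b c : ℕ} (X : Matrix (Fin a) (Fin b) ℝ) (hX : Xᵀ * X = 1)
    (A : Matrix (Fin a) (Fin c) ℝ) : frobNorm (Xᵀ * A) ≤ frobNorm A := by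
  unfold frobNorm
  apply Real.sqrt_le_sqrt
  have h : 0 ≤ ∑ i, ∑ j, ((A - X * (Xᵀ * A)) i j) ^ 2 := by positivity
  have e : (A - X * (Xᵀ * A))ᵀ * (A - X * (Xᵀ * A)) = Aᵀ * A - (Xᵀ * A)ᵀ * (Xᵀ * A) := by
    have e1 : Xᵀ * (A - X * (Xᵀ * A)) = 0 := by
      rw [Matrix.mul_sub, ← Matrix.mul_assoc Xᵀ X, hX, Matrix.one_mul, sub_self]
    rw [Matrix.transpose_sub, Matrix.sub_mul, Matrix.transpose_mul X, Matrix.mul_assoc, e1,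
      Matrix.mul_zero, sub_zero, Matrix.mul_sub, Matrix.transpose_mul Xᵀ A,
      Matrix.transpose_transpose, Matrix.mul_assoc]
  rw [frobSq_eq, e, Matrix.trace_sub] at h
  rw [frobSq_eq, frobSq_eq]
  linarith

lemma frobNorm_smul {a b : ℕ} (t : ℝ) (ht : 0 ≤ t) (A : Matrix (Fin a) (Fin b) ℝ) :
    frobNorm (t • A) = t * frobNorm A := by
  unfold frobNorm
  simp only [Matrix.smul_apply, smul_eq_mul, mul_pow, ← Finset.mul_sum]
  rw [Real.sqrt_mul (by positivity), Real.sqrt_sq ht]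

attribute [local instance] Matrix.frobeniusNormedAddCommGroup in
lemma frobNorm_add {a b : ℕ} (A B : Matrix (Fin a) (Fin b) ℝ) :
    frobNorm (A + B) ≤ frobNorm A + frobNorm B := by
  have h : ∀ C : Matrix (Fin a) (Fin b) ℝ, frobNorm C = ‖C‖ := by
    intro C
    rw [Matrix.frobenius_norm_def, frobNorm, Real.sqrt_eq_rpow]
    simp
  rw [h, h, h]
  exact norm_add_le A B

lemma frobNorm_diag {a m : ℕ} (σ : Fin m → ℝ) (hσ : ∀ k, 0 ≤ σ k)
    (A : Matrix (Fin a) (Fin m) ℝ) :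
    frobNorm (A * Matrix.diagonal σ) ≤ (⨆ k, σ k) * frobNorm A := by
  have hs : 0 ≤ ⨆ k, σ k := Real.iSup_nonneg hσ
  rw [← frobNorm_smul _ hs]
  unfold frobNorm
  apply Real.sqrt_le_sqrt
  refine Finset.sum_le_sum fun i _ => Finset.sum_le_sum fun j _ => ?_
  rw [Matrix.mul_diagonal, Matrix.smul_apply, smul_eq_mul, mul_pow, mul_pow, mul_comm]
  have := le_ciSup (Set.finite_range σ).bddAbove j
  have := hσ j
  gcongr

end helpers

/-- Norm inequality for the implicit Euler scattering update of the ℓ-times-collided flux: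
`‖S_ℓ¹‖_F ≤ (1+ΔtΣ_t)⁻¹·(‖S̃_ℓ^‡‖_F + Δt·max_k σ_k·‖S_{ℓ−1}¹‖_F)`. -/
theorem ell_collided_scattering_update_bound {n m r : ℕ} (hm : 0 < m)
    (Δt St : ℝ) (hΔt : 0 ≤ Δt) (hSt : 0 ≤ St)
    (σ : Fin m → ℝ) (hσ : ∀ k, 0 ≤ σ k)
    (Xl1 Xlm1 : Matrix (Fin n) (Fin r) ℝ)
    (Wl1 Wlm1 : Matrix (Fin m) (Fin r) ℝ)
    (hXl1 : Xl1ᵀ * Xl1 = 1) (hXlm1 : Xlm1ᵀ * Xlm1 = 1)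
    (hWl1 : Wl1ᵀ * Wl1 = 1) (hWlm1 : Wlm1ᵀ * Wlm1 = 1)
    (Stl Slm1 Sl1 : Matrix (Fin r) (Fin r) ℝ)
    (hSl1 : Sl1 = (1 + Δt * St)⁻¹ •
      (Stl + Δt • (Xl1ᵀ * Xlm1 * Slm1 * Wlm1ᵀ * Matrix.diagonal σ * Wl1))) :
    frobNorm Sl1 ≤ (1 + Δt * St)⁻¹ *
      (frobNorm Stl + Δt * (⨆ k : Fin m, σ k) * frobNorm Slm1) := by
  have hc : 0 ≤ (1 + Δt * St)⁻¹ := by positivity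
  rw [hSl1, frobNorm_smul _ hc]
  refine mul_le_mul_of_nonneg_left ?_ hc
  refine (frobNorm_add _ _).trans ?_
  rw [frobNorm_smul _ hΔt, mul_assoc]
  refine add_le_add le_rfl (mul_le_mul_of_nonneg_left ?_ hΔt)
  have e : Xl1ᵀ * Xlm1 * Slm1 * Wlm1ᵀ * Matrix.diagonal σ * Wl1
      = Xl1ᵀ * (Xlm1 * (Slm1 * Wlm1ᵀ * Matrix.diagonal σ * Wl1)) := by
    simp only [Matrix.mul_assoc]
  rw [e]
  refine (frobNorm_contr _ hXl1 _).trans ?_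
  rw [frobNorm_iso _ hXlm1, ← frobNorm_tr, Matrix.transpose_mul]
  refine (frobNorm_contr _ hWl1 _).trans ?_
  rw [frobNorm_tr]
  refine (frobNorm_diag σ hσ _).trans ?_
  rw [← frobNorm_tr (Slm1 * Wlm1ᵀ), Matrix.transpose_mul, Matrix.transpose_transpose,
    frobNorm_iso _ hWlm1, frobNorm_tr]
end

section
/- (Theorem 4, L²-stability of the rank-adaptive collision source DLRA scheme.) Let Δt ≥ 0, Σ_t ≥ 0, and let Σ = diag(σ₁,…,σ_m) ∈ ℝ^{m×m} be diagonal with 0 ≤ σ_k ≤ Σ_t for all k. Let L ≥ 1 and suppose: (i) ψ⁰, ψ¹ ∈ ℝ^{n×n_q} satisfy ‖ψ¹‖_F = ‖ψ⁰‖_F/(1 + ΔtΣ_t); (ii) T_M ∈ ℝ^{n_q×m} has spectral norm ‖T_M‖ ≤ 1; (iii) for each level ℓ ∈ {1,…,L,c} the truncated post-streaming coefficient matrix S_ℓ^‡ satisfies ‖S_ℓ^‡‖_F ≤ ‖S_ℓ⁰‖_F (guaranteed by the CFL condition via the rank-adaptive streaming stability theorem); (iv) for each ℓ ∈ {1,…,L}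 the augmented scattering update holds: Ŝ_ℓ¹ = (1+ΔtΣ_t)^{-1}·( pad(S_ℓ^‡) + Δt·X̂_ℓ^{1,T}·B_ℓ·Σ·Ŵ_ℓ¹ ), where B₁ = ψ¹T_M, B_ℓ = X_{ℓ−1}¹S_{ℓ−1}¹W_{ℓ−1}^{1,T} for ℓ ≥ 2, all matrices X̂_ℓ¹, Ŵ_ℓ¹, X_ℓ¹, W_ℓ¹ have orthonormal columns, and the truncated factors satisfy ‖S_ℓ¹‖_F ≤ ‖Ŝ_ℓ¹‖_F; (v) for the collided flux: Ŝ_c¹ = pad(S_c^‡) + Δt·X̂_c^{1,T}X_L¹S_L¹W_L^{1,T}ΣŴ_c¹ with X̂_c¹, Ŵ_c¹ having orthonormal columns, the truncation gives S̄_c¹, W̃_c¹ with ‖S̄_c¹‖_F ≤ ‖Ŝ_c¹‖_F and W̃_c¹ having orthonormal columns, and the final implicit L-step satisfies S_c¹·W_c^{1,T} = S̄_c¹·W̃_c^{1,T}·(I + ΔtΣ_t·I − Δt·Σ)^{-1} with W_c¹ having orthonormal columns. Then ‖S_c¹‖_F + Σ_{ℓ=1}^{L} ‖S_ℓ¹‖_F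 + ‖ψ¹‖_F ≤ ‖S_c⁰‖_F + Σ_{ℓ=1}^{L} ‖S_ℓ⁰‖_F + ‖ψ⁰‖_F. -/
open Matrix Finset

/-- The spectral norm (largest singular value) of a real matrix. -/
noncomputable def specNormR {p q : ℕ} (A : Matrix (Fin p) (Fin q) ℝ) : ℝ :=
  ‖LinearMap.toContinuousLinearMap (Matrix.toEuclideanLin A)‖

/-- Zero-padding `pad(S) = [[S,0],[0,0]]` of a coefficient matrix, the initial value of the
augmented Galerkin step of the rank-adaptive unconventional integrator. -/
def pad {k : ℕ} (S : Matrix (Fin k) (Fin k) ℝ) :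
    Matrix (Fin k ⊕ Fin k) (Fin k ⊕ Fin k) ℝ :=
  Matrix.fromBlocks S 0 0 0

section Helpers

theorem frob_sq {α β : Type*} [Fintype α] [Fintype β] (A : Matrix α β ℝ) :
    frobNorm A ^ 2 = ∑ i, ∑ j, (A i j) ^ 2 := by
  unfold frobNorm
  exact Real.sq_sqrt (Finset.sum_nonneg fun i _ => Finset.sum_nonneg fun j _ => sq_nonneg _)

theorem frob_nonneg {α β : Type*} [Fintype α] [Fintype β] (A : Matrix α β ℝ) :
    0 ≤ frobNorm A := Real.sqrt_nonneg _

theorem frob_sq_trace {α β : Type*} [Fintype α] [Fintype β] (A : Matrix α β ℝ) :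
    frobNorm A ^ 2 = (A * Aᵀ).trace := by
  rw [frob_sq]
  simp [Matrix.trace, Matrix.mul_apply, sq]

theorem frob_transpose {α β : Type*} [Fintype α] [Fintype β] (A : Matrix α β ℝ) :
    frobNorm Aᵀ = frobNorm A := by
  unfold frobNorm
  rw [Finset.sum_comm]
  rfl

attribute [local instance] Matrix.frobeniusNormedAddCommGroup Matrix.frobeniusNormedSpace in
theorem frob_add_smul {α β : Type*} [Fintype α] [Fintype β] (A B : Matrix α β ℝ) (c : ℝ)
    (hc : 0 ≤ c) :
    frobNorm (A + B) ≤ frobNorm A + frobNorm B ∧ frobNorm (c • A) = c * frobNorm A := by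
  have key : ∀ M : Matrix α β ℝ, frobNorm M = ‖M‖ := by
    intro M
    rw [Matrix.frobenius_norm_def, frobNorm, Real.sqrt_eq_rpow]
    simp
  simp only [key]
  refine ⟨norm_add_le _ _, ?_⟩
  rw [norm_smul, Real.norm_of_nonneg hc]

theorem frob_mul_orth_le {α β γ : Type*} [Fintype α] [Fintype β] [Fintype γ] [DecidableEq γ]
    (A : Matrix α β ℝ) (W : Matrix β γ ℝ) (hW : Wᵀ * W = 1) :
    frobNorm (A * W) ≤ frobNorm A := by
  refine (sq_le_sq₀ (frob_nonneg _) (frob_nonneg _)).1 ?_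
  have h := sq_nonneg (frobNorm (A - A * W * Wᵀ))
  rw [frob_sq_trace] at h
  have e : (A - A * W * Wᵀ) * (A - A * W * Wᵀ)ᵀ = A * Aᵀ - (A * W) * (A * W)ᵀ := by
    simp only [Matrix.transpose_sub, Matrix.transpose_mul, Matrix.transpose_transpose,
      Matrix.mul_sub, Matrix.sub_mul, Matrix.mul_assoc]
    rw [← Matrix.mul_assoc Wᵀ W, hW, Matrix.one_mul]
    abel
  rw [e, Matrix.trace_sub, ← frob_sq_trace, ← frob_sq_trace] at h
  linarith

theorem frob_orth_mul_le {α β γ : Type*} [Fintype α] [Fintype β] [Fintype γ] [DecidableEq γ]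
    (A : Matrix β α ℝ) (X : Matrix β γ ℝ) (hX : Xᵀ * X = 1) :
    frobNorm (Xᵀ * A) ≤ frobNorm A := by
  rw [← frob_transpose, ← frob_transpose A, Matrix.transpose_mul, Matrix.transpose_transpose]
  exact frob_mul_orth_le _ _ hX

theorem frob_mul_orthT {α β γ : Type*} [Fintype α] [Fintype β] [Fintype γ] [DecidableEq γ]
    (A : Matrix α γ ℝ) (W : Matrix β γ ℝ) (hW : Wᵀ * W = 1) :
    frobNorm (A * Wᵀ) = frobNorm A := by
  rw [← sq_eq_sq₀ (frob_nonneg _) (frob_nonneg _), frob_sq_trace, frob_sq_trace]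
  simp only [Matrix.transpose_mul, Matrix.transpose_transpose, Matrix.mul_assoc]
  rw [← Matrix.mul_assoc Wᵀ W, hW, Matrix.one_mul]

theorem frob_orth_mul {α β γ : Type*} [Fintype α] [Fintype β] [Fintype γ] [DecidableEq γ]
    (A : Matrix γ α ℝ) (X : Matrix β γ ℝ) (hX : Xᵀ * X = 1) :
    frobNorm (X * A) = frobNorm A := by
  rw [← frob_transpose, ← frob_transpose A, Matrix.transpose_mul]
  exact frob_mul_orthT _ _ hX

theorem frob_mul_diag_le {α β : Type*} [Fintype α] [Fintype β] [DecidableEq β]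
    (A : Matrix α β ℝ) (d : β → ℝ) (c : ℝ) (hd : ∀ k, 0 ≤ d k ∧ d k ≤ c) (hc : 0 ≤ c) :
    frobNorm (A * Matrix.diagonal d) ≤ c * frobNorm A := by
  refine (sq_le_sq₀ (frob_nonneg _) (mul_nonneg hc (frob_nonneg _))).1 ?_
  rw [mul_pow, frob_sq, frob_sq, Finset.mul_sum]
  refine Finset.sum_le_sum fun i _ => ?_
  rw [Finset.mul_sum]
  refine Finset.sum_le_sum fun j _ => ?_
  rw [Matrix.mul_diagonal, mul_pow, mul_comm]
  exact mul_le_mul_of_nonneg_right (pow_le_pow_left₀ (hd j).1 (hd j).2 2) (sq_nonneg _)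

attribute [local instance] Matrix.instL2OpNormedAddCommGroup in
theorem frob_mul_spec_le {n p q : ℕ} (A : Matrix (Fin n) (Fin p) ℝ) (T : Matrix (Fin p) (Fin q) ℝ)
    (hT : specNormR T ≤ 1) : frobNorm (A * T) ≤ frobNorm A := by
  have h1 : ‖Tᴴ‖ ≤ 1 := by
    rw [Matrix.l2_opNorm_conjTranspose]
    exact hT
  refine (sq_le_sq₀ (frob_nonneg _) (frob_nonneg _)).1 ?_
  rw [frob_sq, frob_sq]
  refine Finset.sum_le_sum fun i _ => ?_
  have h2 := Matrix.l2_opNorm_mulVec Tᴴ (WithLp.toLp 2 (A i))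
  have h3 := h2.trans (mul_le_of_le_one_left (norm_nonneg _) h1)
  have h4 := pow_le_pow_left₀ (norm_nonneg _) h3 2
  rw [EuclideanSpace.norm_sq_eq, EuclideanSpace.norm_sq_eq] at h4
  simpa [Matrix.mulVec, dotProduct, Matrix.mul_apply, mul_comm] using h4

theorem frob_pad {k : ℕ} (S : Matrix (Fin k) (Fin k) ℝ) : frobNorm (pad S) = frobNorm S := by
  unfold frobNorm pad
  simp [Fintype.sum_sum_type]

theorem frob_src {n m : ℕ} {γ : Type*} [Fintype γ] [DecidableEq γ] (B : Matrix (Fin n) (Fin m) ℝ)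
    (X : Matrix (Fin n) γ ℝ) (W : Matrix (Fin m) γ ℝ) (hX : Xᵀ * X = 1) (hW : Wᵀ * W = 1)
    (σ : Fin m → ℝ) (St : ℝ) (hSt : 0 ≤ St) (hσ : ∀ k, 0 ≤ σ k ∧ σ k ≤ St)
    (P : Matrix γ γ ℝ) (Δt : ℝ) (hΔt : 0 ≤ Δt) :
    frobNorm (P + Δt • (Xᵀ * B * Matrix.diagonal σ * W)) ≤
      frobNorm P + Δt * St * frobNorm B := by
  refine (frob_add_smul P _ 0 le_rfl).1.trans ?_
  rw [(frob_add_smul _ 0 Δt hΔt).2, mul_assoc]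
  gcongr
  refine (frob_mul_orth_le _ _ hW).trans ((frob_mul_diag_le _ _ St hσ hSt).trans ?_)
  gcongr
  exact frob_orth_mul_le _ _ hX

theorem tele (b : ℝ) (s p : ℕ → ℝ) (L : ℕ)
    (h : ∀ l, l + 1 ≤ L → (1 + b) * s (l + 1) ≤ p (l + 1) + b * s l) :
    ∑ l ∈ Finset.Icc 1 L, s l + b * s L ≤ ∑ l ∈ Finset.Icc 1 L, p l + b * s 0 := by
  induction L with
  | zero => simp
  | succ L ih =>
    rw [Finset.sum_Icc_succ_top (by omega), Finset.sum_Icc_succ_top (by omega)]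
    have := ih fun l hl => h l (by omega)
    have := h L le_rfl
    linarith

end Helpers

/-- **Theorem 4 (L²-stability of the rank-adaptive collision source DLRA scheme).**
Under `0 ≤ σ_k ≤ Σ_t`, `Δt ≥ 0`, nonexpansive (truncated) streaming steps and the
augmented-basis implicit Euler scattering updates with SVD truncation, one has
`‖S_c¹‖_F + Σ_ℓ ‖S_ℓ¹‖_F + ‖ψ¹‖_F ≤ ‖S_c⁰‖_F + Σ_ℓ ‖S_ℓ⁰‖_F + ‖ψ⁰‖_F`. -/
theorem rank_adaptive_collision_source_DLRA_L2_stable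
    {n nq m : ℕ} (hm : 0 < m)
    (Δt St : ℝ) (hΔt : 0 ≤ Δt) (hSt : 0 ≤ St)
    (σ : Fin m → ℝ) (hσ : ∀ k, 0 ≤ σ k ∧ σ k ≤ St)
    (L : ℕ) (hL : 1 ≤ L)
    -- (i) uncollided flux, implicit Euler
    (ψ0 ψ1 : Matrix (Fin n) (Fin nq) ℝ)
    (hψ : frobNorm ψ1 = frobNorm ψ0 / (1 + Δt * St))
    -- (ii) moment map
    (TM : Matrix (Fin nq) (Fin m) ℝ) (hTM : specNormR TM ≤ 1)
    -- level data: initial, post-streaming (truncated) and updated (truncated) ranks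
    (r0 rS r1 : ℕ → ℕ)
    (S0 : ∀ ℓ : ℕ, Matrix (Fin (r0 ℓ)) (Fin (r0 ℓ)) ℝ)
    (Spost : ∀ ℓ : ℕ, Matrix (Fin (rS ℓ)) (Fin (rS ℓ)) ℝ)
    (Shat1 : ∀ ℓ : ℕ, Matrix (Fin (rS ℓ) ⊕ Fin (rS ℓ)) (Fin (rS ℓ) ⊕ Fin (rS ℓ)) ℝ)
    (Xhat1 : ∀ ℓ : ℕ, Matrix (Fin n) (Fin (rS ℓ) ⊕ Fin (rS ℓ)) ℝ)
    (What1 : ∀ ℓ : ℕ, Matrix (Fin m) (Fin (rS ℓ) ⊕ Fin (rS ℓ)) ℝ)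
    (S1 : ∀ ℓ : ℕ, Matrix (Fin (r1 ℓ)) (Fin (r1 ℓ)) ℝ)
    (X1 : ∀ ℓ : ℕ, Matrix (Fin n) (Fin (r1 ℓ)) ℝ)
    (W1 : ∀ ℓ : ℕ, Matrix (Fin m) (Fin (r1 ℓ)) ℝ)
    -- collided flux data
    (rc0 rcS rc1 : ℕ)
    (Sc0 : Matrix (Fin rc0) (Fin rc0) ℝ) (Spostc : Matrix (Fin rcS) (Fin rcS) ℝ)
    (Shatc1 : Matrix (Fin rcS ⊕ Fin rcS) (Fin rcS ⊕ Fin rcS) ℝ)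
    (Xhatc1 : Matrix (Fin n) (Fin rcS ⊕ Fin rcS) ℝ)
    (Whatc1 : Matrix (Fin m) (Fin rcS ⊕ Fin rcS) ℝ)
    (Sbc1 Sc1 : Matrix (Fin rc1) (Fin rc1) ℝ)
    (Wtc1 Wc1 : Matrix (Fin m) (Fin rc1) ℝ)
    -- (iii) post-streaming truncated coefficient matrices are nonexpansive
    (hstream : ∀ ℓ ∈ Finset.Icc 1 L, frobNorm (Spost ℓ) ≤ frobNorm (S0 ℓ))
    (hstreamc : frobNorm Spostc ≤ frobNorm Sc0)
    -- (iv) orthonormal bases, augmented scattering updates and truncation for ℓ = 1,…,L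
    (horthhat : ∀ ℓ ∈ Finset.Icc 1 L,
      (Xhat1 ℓ)ᵀ * Xhat1 ℓ = 1 ∧ (What1 ℓ)ᵀ * What1 ℓ = 1)
    (horth : ∀ ℓ ∈ Finset.Icc 1 L, (X1 ℓ)ᵀ * X1 ℓ = 1 ∧ (W1 ℓ)ᵀ * W1 ℓ = 1)
    (hupd1 : Shat1 1 = (1 + Δt * St)⁻¹ •
      (pad (Spost 1) + Δt • ((Xhat1 1)ᵀ * (ψ1 * TM) * Matrix.diagonal σ * What1 1)))
    (hupd : ∀ ℓ, 2 ≤ ℓ → ℓ ≤ L → Shat1 ℓ = (1 + Δt * St)⁻¹ •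
      (pad (Spost ℓ) + Δt • ((Xhat1 ℓ)ᵀ *
        (X1 (ℓ - 1) * S1 (ℓ - 1) * (W1 (ℓ - 1))ᵀ) * Matrix.diagonal σ * What1 ℓ)))
    (htrunc : ∀ ℓ ∈ Finset.Icc 1 L, frobNorm (S1 ℓ) ≤ frobNorm (Shat1 ℓ))
    -- (v) collided flux: augmented update, truncation and final implicit L-step
    (hXhatc1 : Xhatc1ᵀ * Xhatc1 = 1) (hWhatc1 : Whatc1ᵀ * Whatc1 = 1)
    (hShatc1 : Shatc1 = pad Spostc + Δt •
      (Xhatc1ᵀ * X1 L * S1 L * (W1 L)ᵀ * Matrix.diagonal σ * Whatc1))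
    (htruncc : frobNorm Sbc1 ≤ frobNorm Shatc1)
    (hWtc1 : Wtc1ᵀ * Wtc1 = 1) (hWc1 : Wc1ᵀ * Wc1 = 1)
    (hSc1 : Sc1 * Wc1ᵀ = Sbc1 * Wtc1ᵀ *
      ((1 : Matrix (Fin m) (Fin m) ℝ) + (Δt * St) • (1 : Matrix (Fin m) (Fin m) ℝ)
        - Δt • Matrix.diagonal σ)⁻¹) :
    frobNorm Sc1 + ∑ ℓ ∈ Finset.Icc 1 L, frobNorm (S1 ℓ) + frobNorm ψ1 ≤
      frobNorm Sc0 + ∑ ℓ ∈ Finset.Icc 1 L, frobNorm (S0 ℓ) + frobNorm ψ0 := by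
  have hb : 0 ≤ Δt * St := mul_nonneg hΔt hSt
  have ha : 0 < 1 + Δt * St := by linarith
  have hu : ∀ l ∈ Finset.Icc 1 L, frobNorm (X1 l * S1 l * (W1 l)ᵀ) = frobNorm (S1 l) := by
    intro l hl
    rw [frob_mul_orthT _ _ (horth l hl).2, frob_orth_mul _ _ (horth l hl).1]
  -- levels
  have hdiv : ∀ l ∈ Finset.Icc 1 L, ∀ B : Matrix (Fin n) (Fin m) ℝ,
      Shat1 l = (1 + Δt * St)⁻¹ •
        (pad (Spost l) + Δt • ((Xhat1 l)ᵀ * B * Matrix.diagonal σ * What1 l)) →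
      (1 + Δt * St) * frobNorm (S1 l) ≤ frobNorm (S0 l) + Δt * St * frobNorm B := by
    intro l hl B hB
    have h1 := htrunc l hl
    rw [hB, (frob_add_smul _ 0 _ (inv_nonneg.2 ha.le)).2] at h1
    have h2 := frob_src B _ _ (horthhat l hl).1 (horthhat l hl).2 σ St hSt hσ
      (pad (Spost l)) Δt hΔt
    rw [frob_pad] at h2
    have h3 := hstream l hl
    have h4 := mul_le_mul_of_nonneg_left h1 ha.le
    rw [mul_inv_cancel_left₀ ha.ne'] at h4
    linarith
  have htele := tele (Δt * St) (fun l => if l = 0 then frobNorm ψ1 else frobNorm (S1 l))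
    (fun l => frobNorm (S0 l)) L (by
      intro l hl
      have hmem : l + 1 ∈ Finset.Icc 1 L := Finset.mem_Icc.2 ⟨by omega, hl⟩
      rcases Nat.eq_zero_or_pos l with rfl | hpos
      · have h := hdiv 1 hmem _ hupd1
        have h' := mul_le_mul_of_nonneg_left (frob_mul_spec_le ψ1 TM hTM) hb
        simp
        linarith
      · have h := hdiv (l + 1) hmem (X1 l * S1 l * (W1 l)ᵀ) (hupd (l + 1) (by omega) hl)
        have h' := hu l (Finset.mem_Icc.2 ⟨hpos, by omega⟩)
        rw [h'] at h
        simpa [hpos.ne'] using h)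
  have hsum : ∑ l ∈ Finset.Icc 1 L, (if l = 0 then frobNorm ψ1 else frobNorm (S1 l))
      = ∑ l ∈ Finset.Icc 1 L, frobNorm (S1 l) := by
    refine Finset.sum_congr rfl fun l hl => if_neg ?_
    have := (Finset.mem_Icc.1 hl).1
    omega
  beta_reduce at htele
  rw [hsum, if_neg (show L ≠ 0 by omega), if_pos rfl] at htele
  -- collided
  have hLm : L ∈ Finset.Icc 1 L := Finset.mem_Icc.2 ⟨hL, le_rfl⟩
  have hc1 := frob_src (X1 L * S1 L * (W1 L)ᵀ) _ _ hXhatc1 hWhatc1 σ St hSt hσ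
    (pad Spostc) Δt hΔt
  rw [frob_pad, hu L hLm] at hc1
  have hc2 : frobNorm Shatc1 ≤ frobNorm Spostc + Δt * St * frobNorm (S1 L) := by
    rw [hShatc1]
    simpa only [Matrix.mul_assoc] using hc1
  have hd : ∀ k, 1 ≤ 1 + Δt * St - Δt * σ k := by
    intro k
    have := mul_le_mul_of_nonneg_left (hσ k).2 hΔt
    linarith
  have hinv : ((1 : Matrix (Fin m) (Fin m) ℝ) + (Δt * St) • (1 : Matrix (Fin m) (Fin m) ℝ)
        - Δt • Matrix.diagonal σ)⁻¹ =
      Matrix.diagonal (fun k => (1 + Δt * St - Δt * σ k)⁻¹) := by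
    apply Matrix.inv_eq_right_inv
    have e : ((1 : Matrix (Fin m) (Fin m) ℝ) + (Δt * St) • (1 : Matrix (Fin m) (Fin m) ℝ)
        - Δt • Matrix.diagonal σ) = Matrix.diagonal (fun k => 1 + Δt * St - Δt * σ k) := by
      ext i j
      by_cases hij : i = j
      · subst hij
        simp
      · simp [hij]
    rw [e, Matrix.diagonal_mul_diagonal, ← Matrix.diagonal_one]
    congr 1
    funext k
    exact mul_inv_cancel₀ (by linarith [hd k])
  have hc3 : frobNorm Sc1 ≤ frobNorm Sbc1 := by
    rw [← frob_mul_orthT Sc1 _ hWc1, hSc1, hinv, ← frob_mul_orthT Sbc1 _ hWtc1]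
    refine (frob_mul_diag_le _ _ 1 (fun k => ⟨?_, ?_⟩) zero_le_one).trans (one_mul _).le
    · exact inv_nonneg.2 (by linarith [hd k])
    · exact inv_le_one_of_one_le₀ (hd k)
  have hψ' : frobNorm ψ0 = (1 + Δt * St) * frobNorm ψ1 := by
    rw [hψ]
    field_simp
  rw [hψ']
  linarith
end
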